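/- Let Q be a (Π, ε)-BSLDP channel over X = ∪_{j=1}^m X_j with |X_j| = k_j (each even), and let P_Z = {p_z : z ∈ Z} be the packing family where Z = ∏_j {±1}^{k_j/2} and p_z((j,2i−1)) = 1/k + 2z_{j,i}k_jα/Σ_t k_t², p_z((j,2i)) = 1/k − 2z_{j,i}k_jα/Σ_t k_t². Then the average chi-square divergence satisfies χ²(Q|P_Z) := (1/|Z|) Σ_z Σ_y (p_z^Q(y) − u^Q(y))²/u^Q(y) ≤ 8k α² (e^ε−1)² / Σ_{t=1}^m k_t², where p^Q denotes the output distribution Σ_x p(x)Q(y|x) and u is uniform on X. -/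

import Mathlib

/-- The real sign attached to a Boolean. -/
def boolSign (b : Bool) : ℝ := if b then 1 else -1

theorem boolSign_mul_self (b : Bool) : boolSign b * boolSign b = 1 := by
  cases b <;> simp [boolSign]

theorem boolSign_not (b : Bool) : boolSign (!b) = -boolSign b := by
  cases b <;> simp [boolSign]

/-- Distinct Rademacher signs are uncorrelated. -/
theorem sum_boolSign_mul_boolSign {ι : Type*} [Fintype ι] [DecidableEq ι] (i k : ι) :
    ∑ z : ι → Bool, boolSign (z i) * boolSign (z k)
      = if i = k then (Fintype.card (ι → Bool) : ℝ) else 0 := by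
  split_ifs with h
  · subst h
    simp [boolSign_mul_self]
  · have hinv : Function.Involutive
        (fun z : ι → Bool => Function.update z i (!z i)) := by
      intro z
      simp
    have hflip := Equiv.sum_comp (Function.Involutive.toPerm _ hinv)
      (fun z : ι → Bool => boolSign (z i) * boolSign (z k))
    have hneg : ∀ z : ι → Bool,
        boolSign ((Function.Involutive.toPerm _ hinv) z i) * boolSign (Function.Involutive.toPerm _ hinv z k)
          = -(boolSign (z i) * boolSign (z k)) := by
      intro z
      simp [Function.Involutive.toPerm, Function.update_of_ne (Ne.symm h), boolSign_not]
    simp only [hneg, Finset.sum_neg_distrib] at hflip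
    linarith

/-- Second moment of a Rademacher sum. -/
theorem sum_sq_sum_boolSign_mul {ι : Type*} [Fintype ι] [DecidableEq ι] (a : ι → ℝ) :
    ∑ z : ι → Bool, (∑ i, boolSign (z i) * a i) ^ 2
      = (Fintype.card (ι → Bool) : ℝ) * ∑ i, a i ^ 2 := by
  have hexp : ∀ z : ι → Bool, (∑ i, boolSign (z i) * a i) ^ 2
      = ∑ i, ∑ k, (a i * a k) * (boolSign (z i) * boolSign (z k)) := by
    intro z
    rw [sq, Finset.sum_mul_sum]
    exact Finset.sum_congr rfl fun i _ => Finset.sum_congr rfl fun k _ => by ring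
  simp only [hexp]
  rw [Finset.sum_comm, Finset.mul_sum]
  refine Finset.sum_congr rfl fun i _ => ?_
  rw [Finset.sum_comm]
  simp only [← Finset.mul_sum, sum_boolSign_mul_boolSign]
  simp
  ring

/-- Second moment of a Rademacher sum whose signs are indexed by a dependent pair. -/
theorem sum_sq_sum_sum_boolSign_mul {m : ℕ} {r : Fin m → ℕ} (a : ∀ j, Fin (r j) → ℝ) :
    ∑ z : (j : Fin m) → Fin (r j) → Bool, (∑ j, ∑ i, boolSign (z j i) * a j i) ^ 2
      = (Fintype.card ((j : Fin m) → Fin (r j) → Bool) : ℝ) * ∑ j, ∑ i, a j i ^ 2 := by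
  let e : (((j : Fin m) × Fin (r j)) → Bool) ≃ ((j : Fin m) → Fin (r j) → Bool) :=
    Equiv.piCurry (fun _ _ => Bool)
  have h := sum_sq_sum_boolSign_mul (fun x : (j : Fin m) × Fin (r j) => a x.1 x.2)
  rw [Fintype.sum_sigma, Fintype.card_congr e] at h
  rw [← h, ← Equiv.sum_comp e]
  refine Finset.sum_congr rfl fun z _ => ?_
  rw [Fintype.sum_sigma]
  rfl

/-- A sum over `Fin (2 * n)`, grouped into consecutive pairs. -/
theorem Fin.sum_univ_two_mul {n : ℕ} (f : Fin (2 * n) → ℝ) :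
    ∑ x, f x = ∑ i : Fin n,
      (f ⟨2 * i, by have := i.isLt; omega⟩ + f ⟨2 * i + 1, by have := i.isLt; omega⟩) := by
  rw [← Equiv.sum_comp (finProdFinEquiv.trans (finCongr (mul_comm n 2))) f,
    Fintype.sum_prod_type]
  refine Finset.sum_congr rfl fun i _ => ?_
  rw [Fin.sum_univ_two]
  congr 2 <;> ext <;> (simp [finProdFinEquiv]; try omega)

/-- If the values of a function are within a factor `c` of each other, then any two of them differ
by at most `c - 1` times the average. -/
theorem card_mul_sub_le_of_le_mul {ι : Type*} [Fintype ι] {c : ℝ} (hc : 1 ≤ c)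
    {q : ι → ℝ} (h : ∀ i i', q i ≤ c * q i') (i i' : ι) :
    (Fintype.card ι : ℝ) * (q i - q i') ≤ (c - 1) * ∑ k, q k := by
  obtain ⟨l, -, hl⟩ := Finset.exists_min_image Finset.univ q ⟨i, Finset.mem_univ i⟩
  have hsum : (Fintype.card ι : ℝ) * q l ≤ ∑ k, q k := by
    have := Finset.card_nsmul_le_sum Finset.univ q (q l) hl
    simpa using this
  have hdiff : q i - q i' ≤ (c - 1) * q l := by
    linarith [h i l, hl i' (Finset.mem_univ i')]
  calc (Fintype.card ι : ℝ) * (q i - q i')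
      ≤ (Fintype.card ι : ℝ) * ((c - 1) * q l) := by gcongr
    _ = (c - 1) * ((Fintype.card ι : ℝ) * q l) := by ring
    _ ≤ (c - 1) * ∑ k, q k := mul_le_mul_of_nonneg_left hsum (by linarith)

theorem sq_card_mul_sub_le_of_le_mul {ι : Type*} [Fintype ι] {c : ℝ} (hc : 1 ≤ c)
    {q : ι → ℝ} (h : ∀ i i', q i ≤ c * q i') (i i' : ι) :
    ((Fintype.card ι : ℝ) * (q i - q i')) ^ 2 ≤ ((c - 1) * ∑ k, q k) ^ 2 := by
  refine sq_le_sq' ?_ (card_mul_sub_le_of_le_mul hc h i i')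
  linarith [card_mul_sub_le_of_le_mul hc h i' i]

/-- Chi-square bound for the packing family in the block-structured LDP lower
bound: for any `(Π, ε)`-BSLDP channel `Q` over `X = ∪_j X_j` with even block
sizes `k_j = 2 r_j`, and the packing `p_z` obtained by perturbing matched pairs
within each block by `± 2 k_j α / Σ_t k_t²` according to signs `z`, the average
chi-square divergence between the output distributions `p_z^Q` and `u^Q`
is at most `8 k α² (e^ε - 1)² / Σ_t k_t²`. -/
theorem bsldp_packing_chiSquare_bound
    (m : ℕ) (hm : 0 < m) (r : Fin m → ℕ) (hr : ∀ j, 0 < r j)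
    {Y : Type*} [Fintype Y] (ε α : ℝ) (hε : 0 < ε) (hα : 0 < α)
    (Q : ((j : Fin m) × Fin (2 * r j)) → Y → ℝ)
    (hQ0 : ∀ x y, 0 ≤ Q x y) (hQ1 : ∀ x, ∑ y, Q x y = 1)
    (hLDP : ∀ (j : Fin m) (i i' : Fin (2 * r j)) (y : Y),
      Q ⟨j, i⟩ y ≤ Real.exp ε * Q ⟨j, i'⟩ y)
    (hvalid : ∀ j : Fin m,
      2 * (2 * ((r j : ℕ) : ℝ)) * α / (∑ j', (2 * ((r j' : ℕ) : ℝ)) ^ 2)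
        ≤ 1 / (∑ j', 2 * ((r j' : ℕ) : ℝ))) :
    let kk : ℝ := ∑ j', 2 * ((r j' : ℕ) : ℝ)
    let K2 : ℝ := ∑ j', (2 * ((r j' : ℕ) : ℝ)) ^ 2
    let pz : ((j : Fin m) → Fin (r j) → Bool) → ((j : Fin m) × Fin (2 * r j)) → ℝ :=
      fun z x => 1 / kk +
        (if z x.1 ⟨(x.2 : ℕ) / 2, by have := x.2.isLt; omega⟩ then (1 : ℝ) else -1) *
        (if (x.2 : ℕ) % 2 = 0 then (1 : ℝ) else -1) *
        (2 * (2 * ((r x.1 : ℕ) : ℝ)) * α / K2)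
    (∑ z : (j : Fin m) → Fin (r j) → Bool, ∑ y : Y,
        ((∑ x, pz z x * Q x y) - ∑ x, (1 / kk) * Q x y) ^ 2
          / (∑ x, (1 / kk) * Q x y))
      / (Fintype.card ((j : Fin m) → Fin (r j) → Bool) : ℝ)
      ≤ 8 * kk * α ^ 2 * (Real.exp ε - 1) ^ 2 / K2 := by
  intro kk K2 pz
  set N : ℝ := (Fintype.card ((j : Fin m) → Fin (r j) → Bool) : ℝ) with hN
  have hNpos : 0 < N := by
    rw [hN]
    exact_mod_cast Fintype.card_pos
  have : Nonempty (Fin m) := ⟨⟨0, hm⟩⟩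
  have hrpos : ∀ j, (0 : ℝ) < r j := fun j => by exact_mod_cast hr j
  have hkk : 0 < kk := Finset.sum_pos (fun j _ => by have := hrpos j; positivity)
    Finset.univ_nonempty
  have hK2 : 0 < K2 := Finset.sum_pos (fun j _ => by have := hrpos j; positivity)
    Finset.univ_nonempty
  have hexp : 1 ≤ Real.exp ε := Real.one_le_exp hε.le
  let S : Fin m → Y → ℝ := fun j y => ∑ i, Q ⟨j, i⟩ y
  let T : Y → ℝ := fun y => ∑ j, S j y
  have hS0 : ∀ j y, 0 ≤ S j y := fun j y => Finset.sum_nonneg fun i _ => hQ0 _ _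
  have hT0 : ∀ y, 0 ≤ T y := fun y => Finset.sum_nonneg fun j _ => hS0 j y
  have hST : ∀ j y, S j y ≤ T y := fun j y =>
    Finset.single_le_sum (f := fun j => S j y) (fun j _ => hS0 j y) (Finset.mem_univ j)
  have hSsum : ∀ j, ∑ y, S j y = 2 * (r j : ℝ) := by
    intro j
    simp only [S]
    rw [Finset.sum_comm]
    simp [hQ1]
  have hu : ∀ y, ∑ x, (1 / kk) * Q x y = T y / kk := by
    intro y
    rw [← Finset.mul_sum, Fintype.sum_sigma]
    simp only [T, S]
    ring
  clear_value T
  let d : Y → (j : Fin m) → Fin (r j) → ℝ := fun y j i =>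
    Q ⟨j, ⟨2 * i, by have := i.isLt; omega⟩⟩ y - Q ⟨j, ⟨2 * i + 1, by have := i.isLt; omega⟩⟩ y
  let c : Fin m → ℝ := fun j => 2 * (2 * (r j : ℝ)) * α / K2
  have hdiff : ∀ z y, (∑ x, pz z x * Q x y) - ∑ x, (1 / kk) * Q x y
      = ∑ j, ∑ i, boolSign (z j i) * (c j * d y j i) := by
    intro z y
    rw [← Finset.sum_sub_distrib, Fintype.sum_sigma]
    refine Finset.sum_congr rfl fun j _ => ?_
    rw [Fin.sum_univ_two_mul]
    refine Finset.sum_congr rfl fun i _ => ?_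
    have h1 : (2 * (i : ℕ) + 1) / 2 = i := by omega
    have h2 : (2 * (i : ℕ) + 1) % 2 = 1 := by omega
    have h3 : (2 * (i : ℕ)) / 2 = i := by omega
    have h4 : (2 * (i : ℕ)) % 2 = 0 := by omega
    simp only [pz, c, d, boolSign, h1, h2, h3, h4, Fin.eta]
    split_ifs <;> first | contradiction | ring
  have hd : ∀ y j i, (c j * d y j i) ^ 2
      ≤ (2 * α / K2) ^ 2 * ((Real.exp ε - 1) * S j y) ^ 2 := by
    intro y j i
    have h := sq_card_mul_sub_le_of_le_mul hexp
      (q := fun i => Q ⟨j, i⟩ y) (fun i i' => hLDP j i i' y)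
      ⟨2 * i, by have := i.isLt; omega⟩ ⟨2 * i + 1, by have := i.isLt; omega⟩
    rw [Fintype.card_fin] at h
    push_cast at h
    calc (c j * d y j i) ^ 2 = (2 * α / K2) ^ 2 * (2 * (r j : ℝ) * d y j i) ^ 2 := by
          simp only [c]
          ring
      _ ≤ _ := mul_le_mul_of_nonneg_left h (sq_nonneg _)
  have hdsum : ∀ y, ∑ j, ∑ i, (c j * d y j i) ^ 2
      ≤ (2 * α / K2) ^ 2 * (Real.exp ε - 1) ^ 2 * (∑ j, r j * S j y) * T y := by
    intro y
    rw [Finset.mul_sum, Finset.sum_mul]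
    refine Finset.sum_le_sum fun j _ => ?_
    calc ∑ i, (c j * d y j i) ^ 2
        ≤ ∑ _i : Fin (r j), (2 * α / K2) ^ 2 * ((Real.exp ε - 1) * S j y) ^ 2 :=
          Finset.sum_le_sum fun i _ => hd y j i
      _ = (2 * α / K2) ^ 2 * (Real.exp ε - 1) ^ 2 * (r j * S j y) * S j y := by
          simp
          ring
      _ ≤ _ := mul_le_mul_of_nonneg_left (hST j y)
          (mul_nonneg (by positivity) (mul_nonneg (hrpos j).le (hS0 j y)))
  have hpoint : ∀ y, (∑ j, ∑ i, (c j * d y j i) ^ 2) / (T y / kk)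
      ≤ kk * ((2 * α / K2) ^ 2 * (Real.exp ε - 1) ^ 2) * ∑ j, r j * S j y := by
    intro y
    rcases (hT0 y).eq_or_lt with h | h
    · rw [← h, zero_div, div_zero]
      exact mul_nonneg (by positivity)
        (Finset.sum_nonneg fun j _ => mul_nonneg (hrpos j).le (hS0 j y))
    · rw [div_le_iff₀ (by positivity)]
      refine (hdsum y).trans_eq ?_
      field_simp
  have htotal : ∑ y, ∑ j, (r j : ℝ) * S j y = K2 / 2 := by
    rw [Finset.sum_comm]
    simp only [← Finset.mul_sum, hSsum]
    simp only [K2, Finset.sum_div]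
    exact Finset.sum_congr rfl fun j _ => by ring
  simp only [hdiff]
  simp only [hu]
  rw [Finset.sum_comm]
  simp only [← Finset.sum_div, sum_sq_sum_sum_boolSign_mul]
  simp only [← hN, mul_div_assoc N, ← Finset.mul_sum]
  rw [← mul_div_assoc N, mul_div_cancel_left₀ _ hNpos.ne']
  calc ∑ y, (∑ j, ∑ i, (c j * d y j i) ^ 2) / (T y / kk)
      ≤ ∑ y, kk * ((2 * α / K2) ^ 2 * (Real.exp ε - 1) ^ 2) * ∑ j, r j * S j y :=
        Finset.sum_le_sum fun y _ => hpoint y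
    _ = 2 * kk * α ^ 2 * (Real.exp ε - 1) ^ 2 / K2 := by
        rw [← Finset.mul_sum, htotal]
        field_simp
    _ ≤ 8 * kk * α ^ 2 * (Real.exp ε - 1) ^ 2 / K2 := by
        gcongr
        norm_num
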